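/- Let X ∈ ℂ^{n×n} be Hermitian. Then tr(X Γ(Φ)) = 0 for every continuous Hermitian-m×m-matrix-valued function Φ on 𝕋 (i.e., X is orthogonal to Range Γ in the trace inner product ⟨A,B⟩ = tr(AB*)) if and only if G(e^{jθ})* X G(e^{jθ}) = 0 for all θ ∈ [0, 2π]. -/

import Mathlib

open Matrix MeasureTheory
open scoped ComplexOrder

/-- Entrywise integral over the unit circle, `∫_{-π}^{π} F(e^{jθ}) dθ/2π`. -/
noncomputable def circleIntM {n m : ℕ} (F : ℝ → Matrix (Fin n) (Fin m) ℂ) :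
    Matrix (Fin n) (Fin m) ℂ :=
  Matrix.of fun i j => (2 * (Real.pi : ℂ))⁻¹ * ∫ θ in (-Real.pi)..Real.pi, F θ i j

/-- The transfer function `G(z) = (zI - A)⁻¹ B` evaluated at `z = e^{jθ}`. -/
noncomputable def Gfun {n m : ℕ} (A : Matrix (Fin n) (Fin n) ℂ)
    (B : Matrix (Fin n) (Fin m) ℂ) (θ : ℝ) : Matrix (Fin n) (Fin m) ℂ :=
  (Complex.exp (θ * Complex.I) • (1 : Matrix (Fin n) (Fin n) ℂ) - A)⁻¹ * B

/-- The pair `(A, B)` is reachable: the controllability matrix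
`[B, AB, ..., A^{n-1}B]` has rank `n`. -/
noncomputable def IsReachable {n m : ℕ} (A : Matrix (Fin n) (Fin n) ℂ)
    (B : Matrix (Fin n) (Fin m) ℂ) : Prop :=
  (Matrix.of fun (i : Fin n) (p : Fin n × Fin m) => (A ^ (p.1 : ℕ) * B) i p.2).rank = n

theorem Gfun_periodic {n m : ℕ} (A : Matrix (Fin n) (Fin n) ℂ) (B : Matrix (Fin n) (Fin m) ℂ) :
    Function.Periodic (Gfun A B) (2 * Real.pi) := by
  intro θ
  have h : Complex.exp (((θ + 2 * Real.pi : ℝ) : ℂ) * Complex.I) = Complex.exp (θ * Complex.I) := by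
    push_cast
    rw [add_mul, Complex.exp_periodic]
  simp only [Gfun, h]

theorem continuous_Gfun {n m : ℕ} {A : Matrix (Fin n) (Fin n) ℂ} (B : Matrix (Fin n) (Fin m) ℂ)
    (hA : ∀ z ∈ spectrum ℂ A, ‖z‖ < 1) : Continuous (Gfun A B) := by
  have hdet : ∀ θ : ℝ,
      (Complex.exp (θ * Complex.I) • (1 : Matrix (Fin n) (Fin n) ℂ) - A).det ≠ 0 := by
    intro θ h0
    have hmem : Complex.exp (θ * Complex.I) ∈ spectrum ℂ A := by
      rw [spectrum.mem_iff, Algebra.algebraMap_eq_smul_one, Matrix.isUnit_iff_isUnit_det, h0]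
      simp
    have := hA _ hmem
    rw [Complex.norm_exp_ofReal_mul_I] at this
    exact lt_irrefl _ this
  have hc : Continuous fun θ : ℝ =>
      Complex.exp (θ * Complex.I) • (1 : Matrix (Fin n) (Fin n) ℂ) - A := by fun_prop
  unfold Gfun
  simp only [Matrix.inv_def, Ring.inverse_eq_inv']
  exact ((hc.matrix_det.inv₀ hdet).smul hc.matrix_adjugate).matrix_mul continuous_const

/-- A constant matrix factor and the trace can be moved inside the entrywise integral. -/
theorem trace_mul_circleIntM {n m : ℕ} (X : Matrix (Fin m) (Fin n) ℂ)
    {F : ℝ → Matrix (Fin n) (Fin m) ℂ} (hF : Continuous F) :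
    Matrix.trace (X * circleIntM F) =
      (2 * (Real.pi : ℂ))⁻¹ * ∫ θ in (-Real.pi)..Real.pi, Matrix.trace (X * F θ) := by
  have hc : ∀ i j, Continuous fun θ => X i j * F θ j i :=
    fun i j => continuous_const.mul (hF.matrix_elem j i)
  have hcs : ∀ i, Continuous fun θ => ∑ j, X i j * F θ j i :=
    fun i => continuous_finsetSum _ fun j _ => hc i j
  simp only [Matrix.trace, Matrix.diag_apply, Matrix.mul_apply, circleIntM, Matrix.of_apply]
  rw [intervalIntegral.integral_finsetSum fun i _ => (hcs i).intervalIntegrable _ _,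
    Finset.mul_sum]
  refine Finset.sum_congr rfl fun i _ => ?_
  rw [intervalIntegral.integral_finsetSum fun j _ => (hc i j).intervalIntegrable _ _,
    Finset.mul_sum]
  refine Finset.sum_congr rfl fun j _ => ?_
  rw [intervalIntegral.integral_const_mul]
  ring

theorem trace_conjTranspose_mul_self_eq_ofReal {m n : ℕ} (H : Matrix (Fin m) (Fin n) ℂ) :
    Matrix.trace (Hᴴ * H) = ((∑ j, ∑ i, ‖H i j‖ ^ 2 : ℝ) : ℂ) := by
  simp [Matrix.trace, Matrix.mul_apply, Complex.conj_mul']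

/-- A continuous periodic matrix function whose squared Frobenius norm has zero integral over a
period vanishes. -/
theorem eq_zero_of_integral_trace_eq_zero {m n : ℕ} {H : ℝ → Matrix (Fin m) (Fin n) ℂ}
    (hc : Continuous H) (hp : Function.Periodic H (2 * Real.pi))
    (h0 : ∫ θ in (-Real.pi)..Real.pi, Matrix.trace ((H θ)ᴴ * H θ) = 0)
    {θ : ℝ} (hθ : θ ∈ Set.Icc 0 (2 * Real.pi)) : H θ = 0 := by
  simp only [trace_conjTranspose_mul_self_eq_ofReal] at h0
  rw [intervalIntegral.integral_ofReal, Complex.ofReal_eq_zero] at h0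
  set f : ℝ → ℝ := fun θ => ∑ j, ∑ i, ‖H θ i j‖ ^ 2 with hf
  have hfc : Continuous f := continuous_finsetSum _ fun j _ => continuous_finsetSum _ fun i _ =>
    (hc.matrix_elem i j).norm.pow 2
  have hfp : Function.Periodic f (2 * Real.pi) := fun θ => by simp only [hf, hp θ]
  have hnn : ∀ θ, 0 ≤ f θ := fun θ => by positivity
  have hshift := hfp.intervalIntegral_add_eq (-Real.pi) 0
  rw [zero_add, show -Real.pi + 2 * Real.pi = Real.pi by ring, h0] at hshift
  have hz : f θ = 0 := by
    by_contra hne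
    exact (intervalIntegral.integral_pos (by positivity) hfc.continuousOn (fun x _ => hnn x)
      ⟨θ, hθ, (hnn θ).lt_of_ne' hne⟩).ne hshift
  rw [← Matrix.trace_conjTranspose_mul_self_eq_zero_iff, trace_conjTranspose_mul_self_eq_ofReal]
  exact_mod_cast hz

theorem stmt2 {n m : ℕ} (A : Matrix (Fin n) (Fin n) ℂ) (B : Matrix (Fin n) (Fin m) ℂ)
    (hA : ∀ z ∈ spectrum ℂ A, ‖z‖ < 1) (hB : B.rank = m) (hAB : IsReachable A B)
    (X : Matrix (Fin n) (Fin n) ℂ) (hX : X.IsHermitian) :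
    (∀ Φ : ℝ → Matrix (Fin m) (Fin m) ℂ,
        Continuous Φ → Function.Periodic Φ (2 * Real.pi) →
        (∀ θ : ℝ, (Φ θ).IsHermitian) →
        Matrix.trace (X * circleIntM (fun θ => Gfun A B θ * Φ θ * (Gfun A B θ)ᴴ)) = 0) ↔
      (∀ θ ∈ Set.Icc (0 : ℝ) (2 * Real.pi), (Gfun A B θ)ᴴ * X * Gfun A B θ = 0) := by
  have hG := continuous_Gfun B hA
  have hGp := Gfun_periodic A B
  have hHc : Continuous fun θ => (Gfun A B θ)ᴴ * X * Gfun A B θ :=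
    (hG.matrix_conjTranspose.matrix_mul continuous_const).matrix_mul hG
  have hHp : Function.Periodic (fun θ => (Gfun A B θ)ᴴ * X * Gfun A B θ) (2 * Real.pi) :=
    fun θ => by simp only [hGp θ]
  have hHh : ∀ θ, ((Gfun A B θ)ᴴ * X * Gfun A B θ).IsHermitian :=
    fun θ => isHermitian_conjTranspose_mul_mul _ hX
  have key : ∀ Φ : ℝ → Matrix (Fin m) (Fin m) ℂ, Continuous Φ →
      Matrix.trace (X * circleIntM (fun θ => Gfun A B θ * Φ θ * (Gfun A B θ)ᴴ)) =
        (2 * (Real.pi : ℂ))⁻¹ * ∫ θ in (-Real.pi)..Real.pi,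
          Matrix.trace ((Gfun A B θ)ᴴ * X * Gfun A B θ * Φ θ) := by
    intro Φ hΦ
    rw [trace_mul_circleIntM X
      ((hG.matrix_mul hΦ).matrix_mul hG.matrix_conjTranspose)]
    congr 2 with θ
    rw [← Matrix.mul_assoc, Matrix.trace_mul_comm]
    simp only [Matrix.mul_assoc]
  constructor
  · intro h θ hθ
    have h0 := h _ hHc hHp hHh
    rw [key _ hHc, mul_eq_zero_iff_left (by simp [Real.pi_ne_zero])] at h0
    refine eq_zero_of_integral_trace_eq_zero hHc hHp ?_ hθ
    simpa only [(hHh _).eq] using h0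
  · intro h Φ hΦ _ _
    have hz : ∀ θ, (Gfun A B θ)ᴴ * X * Gfun A B θ = 0 := by
      intro θ
      obtain ⟨t, ht, hθt⟩ := hHp.exists_mem_Ico₀ Real.two_pi_pos θ
      exact hθt.trans (h t (Set.Ico_subset_Icc_self ht))
    simp [key Φ hΦ, hz]
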